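/- Let w1, w2 be even integers ≥ 2. The diagonal evaluation map ψ : V_{w1,w2}^ℚ[I_D] → W_{w1+w2}^ℚ, P(X1,X2) ↦ P(Z,Z), is well defined and surjective, and admits the following explicit rational section: if P(Z) = Σ_{m=0}^{w1+w2} C(w1+w2, m) a_m (−Z)^{w1+w2−m} lies in W_{w1+w2}^ℚ, then Q(X1,X2) = Σ_{m1=0}^{w1} Σ_{m2=0}^{w2} C(w1,m1) C(w2,m2) a_{m1+m2} (−X1)^{w1−m1} (−X2)^{w2−m2} lies in V_{w1,w2}^ℚ[I_D] and satisfies Q(Z,Z) = P(Z). -/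

import Mathlib

open MvPolynomial

/-- `SL(2, ℤ)`. -/
abbrev SL2Z := Matrix.SpecialLinearGroup (Fin 2) ℤ

/-- `S = [[0,-1],[1,0]]`. -/
def matS : SL2Z := ⟨!![0, -1; 1, 0], by norm_num [Matrix.det_fin_two_of]⟩

/-- `U = [[0,1],[-1,1]]`. -/
def matU : SL2Z := ⟨!![0, 1; -1, 1], by norm_num [Matrix.det_fin_two_of]⟩

/-- `T = [[1,1],[0,1]]`. -/
def matT : SL2Z := ⟨!![1, 1; 0, 1], by norm_num [Matrix.det_fin_two_of]⟩

/-- The weight-`w` action of `γ = [[a,b],[c,d]] ∈ SL(2,ℤ)` on a one-variable polynomial of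
degree ≤ w : `(γ·Q)(X) = (-cX+a)^w Q((dX-b)/(-cX+a))`, written coefficientwise. -/
noncomputable def polyAct1 {R : Type*} [CommRing R] (w : ℕ) (γ : SL2Z) (Q : Polynomial R) :
    Polynomial R :=
  ∑ m ∈ Finset.range (w + 1),
    Polynomial.C (Q.coeff m) *
      (Polynomial.C ((γ.1 1 1 : ℤ) : R) * Polynomial.X - Polynomial.C ((γ.1 0 1 : ℤ) : R)) ^ m *
      (Polynomial.C (-((γ.1 1 0 : ℤ) : R)) * Polynomial.X + Polynomial.C ((γ.1 0 0 : ℤ) : R)) ^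
        (w - m)

/-- `((dX-b)^m) * ((-cX+a)^n)` for `γ = [[a,b],[c,d]]`, in the variable `x`. -/
noncomputable def mfrac {R : Type*} [CommRing R] (γ : SL2Z) (x : MvPolynomial (Fin 2) R)
    (m n : ℕ) : MvPolynomial (Fin 2) R :=
  (MvPolynomial.C ((γ.1 1 1 : ℤ) : R) * x - MvPolynomial.C ((γ.1 0 1 : ℤ) : R)) ^ m *
    (MvPolynomial.C (-((γ.1 1 0 : ℤ) : R)) * x + MvPolynomial.C ((γ.1 0 0 : ℤ) : R)) ^ n

/-- The action of a pair `(γ1, γ2) ∈ SL(2,ℤ)²` on polynomials in `X1 = X 0`, `X2 = X 1` of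
degree ≤ w1 in `X1` and ≤ w2 in `X2`: the weight-`w1` action on `X1` via `γ1` and the
weight-`w2` action on `X2` via `γ2`. -/
noncomputable def polyAct2 {R : Type*} [CommRing R] (w1 w2 : ℕ) (γ1 γ2 : SL2Z)
    (P : MvPolynomial (Fin 2) R) : MvPolynomial (Fin 2) R :=
  ∑ m1 ∈ Finset.range (w1 + 1), ∑ m2 ∈ Finset.range (w2 + 1),
    MvPolynomial.C (MvPolynomial.coeff (Finsupp.single 0 m1 + Finsupp.single 1 m2) P) *
      mfrac γ1 (MvPolynomial.X 0) m1 (w1 - m1) * mfrac γ2 (MvPolynomial.X 1) m2 (w2 - m2)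

/-- Membership in `V_w^ℚ` : degree at most `w`. -/
def MemV1 (w : ℕ) (P : Polynomial ℚ) : Prop := P.natDegree ≤ w

/-- Membership in `W_w^ℚ = {P ∈ V_w^ℚ : (1+S)·P = 0, (1+U+U²)·P = 0}`. -/
def MemW1 (w : ℕ) (P : Polynomial ℚ) : Prop :=
  MemV1 w P ∧ P + polyAct1 w matS P = 0 ∧
    P + polyAct1 w matU P + polyAct1 w (matU ^ 2) P = 0

/-- Membership in `V_{w1,w2}^ℚ` : degree ≤ w1 in `X1 = X 0` and ≤ w2 in `X2 = X 1`. -/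
def MemV2 (w1 w2 : ℕ) (P : MvPolynomial (Fin 2) ℚ) : Prop :=
  MvPolynomial.degreeOf 0 P ≤ w1 ∧ MvPolynomial.degreeOf 1 P ≤ w2

/-- The embedding `P1(X) ↦ P1(X1)` of one-variable polynomials in the variable `X1 = X 0`. -/
noncomputable def toX1 (P1 : Polynomial ℚ) : MvPolynomial (Fin 2) ℚ :=
  Polynomial.aeval (MvPolynomial.X 0 : MvPolynomial (Fin 2) ℚ) P1


/-- The embedding `P2(X) ↦ P2(X2)` of one-variable polynomials in the variable `X2 = X 1`. -/
noncomputable def toX2 (P2 : Polynomial ℚ) : MvPolynomial (Fin 2) ℚ :=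
  Polynomial.aeval (MvPolynomial.X 1 : MvPolynomial (Fin 2) ℚ) P2

/-- Membership in `V_{w1,w2}^ℚ[I_D]` : lies in `V_{w1,w2}^ℚ` and is killed by
`(1,1)+(S,S)` and `(1,1)+(U,U)+(U²,U²)`. -/
def MemVID (w1 w2 : ℕ) (P : MvPolynomial (Fin 2) ℚ) : Prop :=
  MemV2 w1 w2 P ∧ P + polyAct2 w1 w2 matS matS P = 0 ∧
    P + polyAct2 w1 w2 matU matU P + polyAct2 w1 w2 (matU ^ 2) (matU ^ 2) P = 0

/-- Diagonal evaluation `P(X1,X2) ↦ P(Z,Z)`. -/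
noncomputable def diagEval (P : MvPolynomial (Fin 2) ℚ) : Polynomial ℚ :=
  MvPolynomial.aeval (fun _ : Fin 2 => (Polynomial.X : Polynomial ℚ)) P

theorem pa1_sum {ι : Type*} (s : Finset ι) (w : ℕ) (γ : SL2Z) (f : ι → Polynomial ℚ) :
    polyAct1 w γ (∑ i ∈ s, f i) = ∑ i ∈ s, polyAct1 w γ (f i) := by
  unfold polyAct1
  rw [Finset.sum_comm]
  refine Finset.sum_congr rfl fun m _ => ?_
  rw [Polynomial.finsetSum_coeff, map_sum, Finset.sum_mul, Finset.sum_mul]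

theorem pa2_sum {ι : Type*} (s : Finset ι) (w1 w2 : ℕ) (γ γ' : SL2Z)
    (f : ι → MvPolynomial (Fin 2) ℚ) :
    polyAct2 w1 w2 γ γ' (∑ i ∈ s, f i) = ∑ i ∈ s, polyAct2 w1 w2 γ γ' (f i) := by
  unfold polyAct2
  conv_rhs => rw [Finset.sum_comm]
  refine Finset.sum_congr rfl fun m _ => ?_
  conv_rhs => rw [Finset.sum_comm]
  refine Finset.sum_congr rfl fun m _ => ?_
  rw [MvPolynomial.coeff_sum, map_sum, Finset.sum_mul, Finset.sum_mul]

theorem pa1_mono (w : ℕ) (γ : SL2Z) (k : ℚ) (n : ℕ) (hn : n ≤ w) :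
    polyAct1 w γ (Polynomial.C k * Polynomial.X ^ n) =
    Polynomial.C k *
      (Polynomial.C ((γ.1 1 1 : ℤ) : ℚ) * Polynomial.X - Polynomial.C ((γ.1 0 1 : ℤ) : ℚ)) ^ n *
      (Polynomial.C (-((γ.1 1 0 : ℤ) : ℚ)) * Polynomial.X + Polynomial.C ((γ.1 0 0 : ℤ) : ℚ)) ^
        (w - n) := by
  unfold polyAct1
  rw [Finset.sum_eq_single n]
  · simp [Polynomial.coeff_C_mul, Polynomial.coeff_X_pow]
  · intro m _ hm
    simp [Polynomial.coeff_C_mul, Polynomial.coeff_X_pow, hm]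
  · intro h
    exact absurd (Finset.mem_range.2 (by omega)) h

theorem mono_form (k : ℚ) (n1 n2 : ℕ) :
    MvPolynomial.C k * MvPolynomial.X 0 ^ n1 * MvPolynomial.X 1 ^ n2 =
    MvPolynomial.monomial (Finsupp.single (0 : Fin 2) n1 + Finsupp.single 1 n2) k := by
  rw [MvPolynomial.X_pow_eq_monomial, MvPolynomial.X_pow_eq_monomial,
    MvPolynomial.C_mul_monomial, MvPolynomial.monomial_mul]
  simp

theorem coeff_form (k : ℚ) (n1 n2 m1 m2 : ℕ) :
    MvPolynomial.coeff (Finsupp.single (0 : Fin 2) m1 + Finsupp.single 1 m2)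
    (MvPolynomial.C k * MvPolynomial.X 0 ^ n1 * MvPolynomial.X 1 ^ n2) =
    if m1 = n1 ∧ m2 = n2 then k else 0 := by
  rw [mono_form, MvPolynomial.coeff_monomial]
  congr 1
  apply propext
  constructor
  · intro h
    have h0 := DFunLike.congr_fun h 0
    have h1 := DFunLike.congr_fun h 1
    simp at h0 h1
    exact ⟨h0.symm, h1.symm⟩
  · rintro ⟨rfl, rfl⟩; rfl

theorem pa2_mono (w1 w2 : ℕ) (γ γ' : SL2Z) (k : ℚ) (n1 n2 : ℕ) (hn1 : n1 ≤ w1) (hn2 : n2 ≤ w2) :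
    polyAct2 w1 w2 γ γ' (MvPolynomial.C k * MvPolynomial.X 0 ^ n1 * MvPolynomial.X 1 ^ n2) =
    MvPolynomial.C k *
      mfrac γ (MvPolynomial.X 0) n1 (w1 - n1) * mfrac γ' (MvPolynomial.X 1) n2 (w2 - n2) := by
  unfold polyAct2
  rw [Finset.sum_eq_single n1]
  · rw [Finset.sum_eq_single n2]
    · simp [coeff_form]
    · intro m _ hm
      simp [coeff_form, hm]
    · intro h
      exact absurd (Finset.mem_range.2 (by omega)) h
  · intro m _ hm
    simp [coeff_form, hm]
  · intro h
    exact absurd (Finset.mem_range.2 (by omega)) h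

theorem mv_as_sum (P : MvPolynomial (Fin 2) ℚ) :
    P = ∑ s ∈ P.support, MvPolynomial.C (P.coeff s) * MvPolynomial.X 0 ^ (s 0) *
      MvPolynomial.X 1 ^ (s 1) := by
  conv_lhs => rw [P.as_sum]
  refine Finset.sum_congr rfl fun s _ => ?_
  rw [mono_form]
  congr 2
  apply Finsupp.ext
  intro i
  fin_cases i <;> simp

theorem diag_act (w1 w2 : ℕ) (γ : SL2Z) (P : MvPolynomial (Fin 2) ℚ) (h : MemV2 w1 w2 P) :
    diagEval (polyAct2 w1 w2 γ γ P) = polyAct1 (w1 + w2) γ (diagEval P) := by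
  have h1 := (MvPolynomial.degreeOf_le_iff).1 h.1
  have h2 := (MvPolynomial.degreeOf_le_iff).1 h.2
  rw [mv_as_sum P, pa2_sum]
  unfold diagEval
  rw [map_sum, map_sum, pa1_sum]
  refine Finset.sum_congr rfl fun s hs => ?_
  have e1 := h1 s hs
  have e2 := h2 s hs
  rw [pa2_mono _ _ _ _ _ _ _ e1 e2]
  have : MvPolynomial.aeval (fun _ : Fin 2 => (Polynomial.X : Polynomial ℚ))
      (MvPolynomial.C (P.coeff s) * MvPolynomial.X 0 ^ (s 0) *
      MvPolynomial.X 1 ^ (s 1)) = Polynomial.C (P.coeff s) * Polynomial.X ^ (s 0 + s 1) := by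
    simp [pow_add, mul_assoc, Polynomial.algebraMap_eq, MvPolynomial.algHom_C]
  rw [this, pa1_mono _ _ _ _ (by omega)]
  rw [show w1 + w2 - (s 0 + s 1) = (w1 - s 0) + (w2 - s 1) by omega]
  unfold mfrac
  simp only [map_mul, map_pow, map_sub, map_add, MvPolynomial.algHom_C, MvPolynomial.aeval_X,
    Polynomial.algebraMap_eq]
  ring

theorem diag_deg (w1 w2 : ℕ) (P : MvPolynomial (Fin 2) ℚ) (h : MemV2 w1 w2 P) :
    (diagEval P).natDegree ≤ w1 + w2 := by
  have h1 := (MvPolynomial.degreeOf_le_iff).1 h.1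
  have h2 := (MvPolynomial.degreeOf_le_iff).1 h.2
  rw [mv_as_sum P]
  unfold diagEval
  rw [map_sum]
  refine Polynomial.natDegree_sum_le_of_forall_le _ _ fun s hs => ?_
  have e1 := h1 s hs
  have e2 := h2 s hs
  have : MvPolynomial.aeval (fun _ : Fin 2 => (Polynomial.X : Polynomial ℚ))
      (MvPolynomial.C (P.coeff s) * MvPolynomial.X 0 ^ (s 0) *
      MvPolynomial.X 1 ^ (s 1)) = Polynomial.C (P.coeff s) * Polynomial.X ^ (s 0 + s 1) := by
    simp [pow_add, mul_assoc, Polynomial.algebraMap_eq, MvPolynomial.algHom_C]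
  rw [this]
  exact (Polynomial.natDegree_C_mul_X_pow_le _ _).trans (by omega)

theorem part1 (w1 w2 : ℕ) (P : MvPolynomial (Fin 2) ℚ) (h : MemVID w1 w2 P) :
    MemW1 (w1 + w2) (diagEval P) := by
  obtain ⟨hV, hS, hU⟩ := h
  refine ⟨diag_deg _ _ _ hV, ?_, ?_⟩
  · rw [← diag_act _ _ _ _ hV]
    have := congrArg diagEval hS
    simpa [diagEval] using this
  · rw [← diag_act _ _ _ _ hV, ← diag_act _ _ _ _ hV]
    have := congrArg diagEval hU
    simpa [diagEval] using this

/-- the functional `T ^ m ↦ a m` -/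
noncomputable def Lf (a : ℕ → ℚ) : Polynomial ℚ →ₗ[ℚ] ℚ :=
  (Polynomial.basisMonomials ℚ).constr ℚ a

theorem Lf_X (a : ℕ → ℚ) (m : ℕ) (k : ℚ) : Lf a (Polynomial.C k * Polynomial.X ^ m) = k * a m := by
  have := (Polynomial.basisMonomials ℚ).constr_basis ℚ a m
  rw [Polynomial.coe_basisMonomials] at this
  rw [← Polynomial.smul_eq_C_mul, map_smul, Polynomial.X_pow_eq_monomial, Lf, this, smul_eq_mul]

noncomputable def P1 (w : ℕ) (a : ℕ → ℚ) : Polynomial ℚ :=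
  ∑ m ∈ Finset.range (w + 1),
          Polynomial.C ((Nat.choose w m : ℚ) * a m) * (-Polynomial.X) ^ (w - m)

noncomputable def Q2 (w1 w2 : ℕ) (a : ℕ → ℚ) : MvPolynomial (Fin 2) ℚ :=
  ∑ m1 ∈ Finset.range (w1 + 1), ∑ m2 ∈ Finset.range (w2 + 1),
          MvPolynomial.C ((Nat.choose w1 m1 : ℚ) * (Nat.choose w2 m2 : ℚ) * a (m1 + m2)) *
            (-MvPolynomial.X 0) ^ (w1 - m1) * (-MvPolynomial.X 1) ^ (w2 - m2)

theorem lin_pow (u v : ℚ) (w : ℕ) : (Polynomial.C v * Polynomial.X - Polynomial.C u) ^ w =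
    ∑ m ∈ Finset.range (w + 1), Polynomial.C ((Nat.choose w m : ℚ) * v ^ m * (-u) ^ (w - m)) *
      Polynomial.X ^ m := by
  rw [sub_eq_add_neg, add_pow]
  refine Finset.sum_congr rfl fun m _ => ?_
  simp only [map_mul, map_pow, map_neg, map_natCast]
  ring

theorem L1 (a : ℕ → ℚ) (u v : ℚ) (w : ℕ) :
    Lf a ((Polynomial.C v * Polynomial.X - Polynomial.C u) ^ w) =
    ∑ m ∈ Finset.range (w + 1), (Nat.choose w m : ℚ) * a m * (-u) ^ (w - m) * v ^ m := by
  rw [lin_pow, map_sum]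
  refine Finset.sum_congr rfl fun m _ => ?_
  rw [Lf_X]; ring

theorem L2 (a : ℕ → ℚ) (u v u' v' : ℚ) (w1 w2 : ℕ) :
    Lf a ((Polynomial.C v * Polynomial.X - Polynomial.C u) ^ w1 *
      (Polynomial.C v' * Polynomial.X - Polynomial.C u') ^ w2) =
    ∑ m1 ∈ Finset.range (w1 + 1), ∑ m2 ∈ Finset.range (w2 + 1),
      (Nat.choose w1 m1 : ℚ) * (Nat.choose w2 m2 : ℚ) * a (m1 + m2) *
        (-u) ^ (w1 - m1) * v ^ m1 * (-u') ^ (w2 - m2) * v' ^ m2 := by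
  rw [lin_pow, lin_pow, Finset.sum_mul_sum, map_sum]
  refine Finset.sum_congr rfl fun m1 _ => ?_
  rw [map_sum]
  refine Finset.sum_congr rfl fun m2 _ => ?_
  rw [mul_mul_mul_comm, ← map_mul, ← pow_add, Lf_X]; ring

theorem eval_P1 (w : ℕ) (a : ℕ → ℚ) (z : ℚ) :
    (P1 w a).eval z = Lf a ((Polynomial.X - Polynomial.C z * 1) ^ w) := by
  have := L1 a z 1 w
  rw [map_one, one_mul] at this
  rw [mul_one, this, P1, Polynomial.eval_finsetSum]
  simp

theorem eval_act_P1 (w : ℕ) (γ : SL2Z) (a : ℕ → ℚ) (z : ℚ) :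
    (polyAct1 w γ (P1 w a)).eval z = Lf a
      (((Polynomial.C ((γ.1 0 0 : ℤ) : ℚ) * Polynomial.X + Polynomial.C ((γ.1 0 1 : ℤ) : ℚ)) -
        Polynomial.C z * (Polynomial.C ((γ.1 1 0 : ℤ) : ℚ) * Polynomial.X +
          Polynomial.C ((γ.1 1 1 : ℤ) : ℚ))) ^ w) := by
  have := L1 a ((γ.1 1 1 : ℤ) * z - (γ.1 0 1 : ℤ)) (-(γ.1 1 0 : ℤ) * z + (γ.1 0 0 : ℤ)) w
  convert this.symm using 1
  · rw [P1, pa1_sum, Polynomial.eval_finsetSum]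
    refine Finset.sum_congr rfl fun m hm => ?_
    have hm' : m ≤ w := by have := Finset.mem_range.1 hm; omega
    rw [neg_pow (Polynomial.X : Polynomial ℚ), ← mul_assoc, show Polynomial.C ((w.choose m : ℚ) * a m) *
      (-1) ^ (w - m) = Polynomial.C ((w.choose m : ℚ) * a m * (-1) ^ (w - m)) by simp,
      pa1_mono _ _ _ _ (by omega), show w - (w - m) = m by omega]
    rw [neg_pow ((γ.1 1 1 : ℤ) * z - (γ.1 0 1 : ℤ) : ℚ)]
    simp only [Polynomial.eval_mul, Polynomial.eval_pow, Polynomial.eval_add, Polynomial.eval_sub,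
      Polynomial.eval_C, Polynomial.eval_X]
    ring
  · congr 2
    simp only [map_mul, map_sub, map_add, map_neg]
    ring

theorem eval_Q2 (w1 w2 : ℕ) (a : ℕ → ℚ) (x : Fin 2 → ℚ) :
    MvPolynomial.eval x (Q2 w1 w2 a) = Lf a ((Polynomial.X - Polynomial.C (x 0) * 1) ^ w1 *
      (Polynomial.X - Polynomial.C (x 1) * 1) ^ w2) := by
  have := L2 a (x 0) 1 (x 1) 1 w1 w2
  rw [map_one, one_mul] at this
  rw [mul_one, mul_one, this, Q2, map_sum]
  refine Finset.sum_congr rfl fun m hm => ?_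
  rw [map_sum]
  simp

theorem eval_act_Q2 (w1 w2 : ℕ) (γ : SL2Z) (a : ℕ → ℚ) (x : Fin 2 → ℚ) :
    MvPolynomial.eval x (polyAct2 w1 w2 γ γ (Q2 w1 w2 a)) = Lf a
      (((Polynomial.C ((γ.1 0 0 : ℤ) : ℚ) * Polynomial.X + Polynomial.C ((γ.1 0 1 : ℤ) : ℚ)) -
        Polynomial.C (x 0) * (Polynomial.C ((γ.1 1 0 : ℤ) : ℚ) * Polynomial.X +
          Polynomial.C ((γ.1 1 1 : ℤ) : ℚ))) ^ w1 *
      ((Polynomial.C ((γ.1 0 0 : ℤ) : ℚ) * Polynomial.X + Polynomial.C ((γ.1 0 1 : ℤ) : ℚ)) -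
        Polynomial.C (x 1) * (Polynomial.C ((γ.1 1 0 : ℤ) : ℚ) * Polynomial.X +
          Polynomial.C ((γ.1 1 1 : ℤ) : ℚ))) ^ w2) := by
  have := L2 a ((γ.1 1 1 : ℤ) * x 0 - (γ.1 0 1 : ℤ)) (-(γ.1 1 0 : ℤ) * x 0 + (γ.1 0 0 : ℤ))
    ((γ.1 1 1 : ℤ) * x 1 - (γ.1 0 1 : ℤ)) (-(γ.1 1 0 : ℤ) * x 1 + (γ.1 0 0 : ℤ)) w1 w2
  convert this.symm using 1
  · rw [Q2, pa2_sum, map_sum]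
    refine Finset.sum_congr rfl fun m hm => ?_
    rw [pa2_sum, map_sum]
    refine Finset.sum_congr rfl fun m2 hm2 => ?_
    have hm' : m ≤ w1 := by have := Finset.mem_range.1 hm; omega
    have hm2' : m2 ≤ w2 := by have := Finset.mem_range.1 hm2; omega
    have e : MvPolynomial.C ((w1.choose m : ℚ) * (w2.choose m2 : ℚ) * a (m + m2)) *
        (-MvPolynomial.X (0 : Fin 2)) ^ (w1 - m) * (-MvPolynomial.X 1) ^ (w2 - m2) =
        MvPolynomial.C ((w1.choose m : ℚ) * (w2.choose m2 : ℚ) * a (m + m2) *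
          (-1) ^ (w1 - m) * (-1) ^ (w2 - m2)) * MvPolynomial.X 0 ^ (w1 - m) *
          MvPolynomial.X 1 ^ (w2 - m2) := by
      rw [neg_pow (MvPolynomial.X 0 : MvPolynomial (Fin 2) ℚ),
      neg_pow (MvPolynomial.X 1 : MvPolynomial (Fin 2) ℚ)]
      simp only [map_mul, map_pow, map_neg, map_one]
      ring
    rw [e, pa2_mono _ _ _ _ _ _ _ (by omega) (by omega), show w1 - (w1 - m) = m by omega,
      show w2 - (w2 - m2) = m2 by omega]
    rw [neg_pow ((γ.1 1 1 : ℤ) * x 0 - (γ.1 0 1 : ℤ) : ℚ),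
      neg_pow ((γ.1 1 1 : ℤ) * x 1 - (γ.1 0 1 : ℤ) : ℚ)]
    simp only [mfrac, map_mul, map_pow, map_add, map_sub, MvPolynomial.eval_C,
      MvPolynomial.eval_X]
    ring
  · congr 3
    · simp only [map_mul, map_sub, map_add, map_neg]
      ring
    · simp only [map_mul, map_sub, map_add, map_neg]
      ring

theorem sub_pow_exp (A D : Polynomial ℚ) (z : ℚ) (w : ℕ) : (A - Polynomial.C z * D) ^ w =
    ∑ k ∈ Finset.range (w + 1), ((w.choose k : ℚ) * (-z) ^ (w - k)) • (A ^ k * D ^ (w - k)) := by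
  rw [sub_eq_add_neg, add_pow]
  refine Finset.sum_congr rfl fun k _ => ?_
  rw [Polynomial.smul_eq_C_mul, ← neg_mul, ← map_neg, mul_pow]
  simp only [map_mul, map_pow, map_natCast]
  ring

theorem key {n : ℕ} (L : Polynomial ℚ →ₗ[ℚ] ℚ) (A D : Fin n → Polynomial ℚ) (w1 w2 : ℕ)
    (h : ∀ z : ℚ, ∑ i, L ((A i - Polynomial.C z * D i) ^ (w1 + w2)) = 0) (x y : ℚ) :
    ∑ i, L ((A i - Polynomial.C x * D i) ^ w1 * (A i - Polynomial.C y * D i) ^ w2) = 0 := by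
  have hc : ∀ k ≤ w1 + w2, ∑ i, L (A i ^ k * D i ^ (w1 + w2 - k)) = 0 := by
    set w := w1 + w2 with hw
    have hp : (∑ k ∈ Finset.range (w + 1), Polynomial.C ((w.choose k : ℚ) * (-1) ^ (w - k) *
        ∑ i, L (A i ^ k * D i ^ (w - k))) * Polynomial.X ^ (w - k) : Polynomial ℚ) = 0 := by
      apply Polynomial.funext
      intro z
      rw [Polynomial.eval_zero, ← h z, Polynomial.eval_finsetSum]
      simp_rw [sub_pow_exp, map_sum]
      rw [Finset.sum_comm]
      refine Finset.sum_congr rfl fun k _ => ?_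
      simp only [map_smul, smul_eq_mul, ← Finset.mul_sum, Polynomial.eval_mul, Polynomial.eval_C,
        Polynomial.eval_pow, Polynomial.eval_X]
      rw [neg_pow z]
      ring
    intro k hk
    have := congrArg (fun p => Polynomial.coeff p (w - k)) hp
    simp only [Polynomial.finsetSum_coeff, Polynomial.coeff_C_mul, Polynomial.coeff_X_pow,
      Polynomial.coeff_zero] at this
    rw [Finset.sum_eq_single k] at this
    · have hk' : (w.choose k : ℚ) ≠ 0 := by exact_mod_cast (Nat.choose_pos hk).ne'
      simpa [hk'] using this
    · intro m hm hne
      have := Finset.mem_range.1 hm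
      rw [if_neg (by omega), mul_zero]
    · intro h
      exact absurd (Finset.mem_range.2 (by omega)) h
  simp_rw [sub_pow_exp, Finset.sum_mul_sum, map_sum]
  rw [Finset.sum_comm]
  refine Finset.sum_eq_zero fun k hk => ?_
  rw [Finset.sum_comm]
  refine Finset.sum_eq_zero fun l hl => ?_
  have hk := Finset.mem_range.1 hk
  have hl := Finset.mem_range.1 hl
  simp_rw [smul_mul_smul_comm, map_smul, smul_eq_mul]
  rw [← Finset.mul_sum]
  have := hc (k + l) (by omega)
  rw [show w1 + w2 - (k + l) = (w1 - k) + (w2 - l) by omega] at this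
  simp_rw [pow_add] at this
  simp_rw [mul_mul_mul_comm]
  rw [this, mul_zero]

theorem Q2_V2 (w1 w2 : ℕ) (a : ℕ → ℚ) : MemV2 w1 w2 (Q2 w1 w2 a) := by
  have e : ∀ (m m2 : ℕ), MvPolynomial.C ((w1.choose m : ℚ) * (w2.choose m2 : ℚ) * a (m + m2)) *
        (-MvPolynomial.X (0 : Fin 2)) ^ (w1 - m) * (-MvPolynomial.X 1) ^ (w2 - m2) =
        MvPolynomial.C ((w1.choose m : ℚ) * (w2.choose m2 : ℚ) * a (m + m2) *
          (-1) ^ (w1 - m) * (-1) ^ (w2 - m2)) * MvPolynomial.X 0 ^ (w1 - m) *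
          MvPolynomial.X 1 ^ (w2 - m2) := by
    intro m m2
    rw [neg_pow (MvPolynomial.X 0 : MvPolynomial (Fin 2) ℚ),
      neg_pow (MvPolynomial.X 1 : MvPolynomial (Fin 2) ℚ)]
    simp only [map_mul, map_pow, map_neg, map_one]
    ring
  unfold Q2
  simp_rw [e, mono_form]
  constructor
  · refine (MvPolynomial.degreeOf_sum_le _ _ _).trans (Finset.sup_le fun m _ => ?_)
    refine (MvPolynomial.degreeOf_sum_le _ _ _).trans (Finset.sup_le fun m2 _ => ?_)
    rw [MvPolynomial.degreeOf_le_iff]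
    intro s hs
    rw [Finset.mem_singleton.1 (MvPolynomial.support_monomial_subset hs)]
    simp
  · refine (MvPolynomial.degreeOf_sum_le _ _ _).trans (Finset.sup_le fun m _ => ?_)
    refine (MvPolynomial.degreeOf_sum_le _ _ _).trans (Finset.sup_le fun m2 _ => ?_)
    rw [MvPolynomial.degreeOf_le_iff]
    intro s hs
    rw [Finset.mem_singleton.1 (MvPolynomial.support_monomial_subset hs)]
    simp

theorem eval_diag (P : MvPolynomial (Fin 2) ℚ) (z : ℚ) :
    (diagEval P).eval z = MvPolynomial.eval (fun _ => z) P := by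
  conv_lhs => rw [mv_as_sum P]
  conv_rhs => rw [mv_as_sum P]
  unfold diagEval
  rw [map_sum, map_sum, Polynomial.eval_finsetSum]
  refine Finset.sum_congr rfl fun s hs => ?_
  simp [MvPolynomial.algHom_C, Polynomial.algebraMap_eq]

theorem part3 (w1 w2 : ℕ) (a : ℕ → ℚ) (h : MemW1 (w1 + w2) (P1 (w1 + w2) a)) :
    MemVID w1 w2 (Q2 w1 w2 a) ∧ diagEval (Q2 w1 w2 a) = P1 (w1 + w2) a := by
  obtain ⟨_, hS, hU⟩ := h
  refine ⟨⟨Q2_V2 _ _ _, ?_, ?_⟩, ?_⟩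
  · apply MvPolynomial.funext
    intro x
    have := key (n := 2) (Lf a)
      ![Polynomial.X, Polynomial.C ((matS.1 0 0 : ℤ) : ℚ) * Polynomial.X +
          Polynomial.C ((matS.1 0 1 : ℤ) : ℚ)]
      ![1, Polynomial.C ((matS.1 1 0 : ℤ) : ℚ) * Polynomial.X +
          Polynomial.C ((matS.1 1 1 : ℤ) : ℚ)] w1 w2 ?_ (x 0) (x 1)
    · rw [map_add, eval_Q2, eval_act_Q2, map_zero]
      rw [Fin.sum_univ_two] at this
      exact this
    · intro z
      rw [Fin.sum_univ_two]
      have := congrArg (Polynomial.eval z) hS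
      rw [Polynomial.eval_add, eval_P1, eval_act_P1, Polynomial.eval_zero] at this
      exact this
  · apply MvPolynomial.funext
    intro x
    have := key (n := 3) (Lf a)
      ![Polynomial.X, Polynomial.C ((matU.1 0 0 : ℤ) : ℚ) * Polynomial.X +
          Polynomial.C ((matU.1 0 1 : ℤ) : ℚ),
          Polynomial.C (((matU ^ 2).1 0 0 : ℤ) : ℚ) * Polynomial.X +
          Polynomial.C (((matU ^ 2).1 0 1 : ℤ) : ℚ)]
      ![1, Polynomial.C ((matU.1 1 0 : ℤ) : ℚ) * Polynomial.X +
          Polynomial.C ((matU.1 1 1 : ℤ) : ℚ),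
          Polynomial.C (((matU ^ 2).1 1 0 : ℤ) : ℚ) * Polynomial.X +
          Polynomial.C (((matU ^ 2).1 1 1 : ℤ) : ℚ)] w1 w2 ?_ (x 0) (x 1)
    · rw [map_add, map_add, eval_Q2, eval_act_Q2, eval_act_Q2, map_zero]
      rw [Fin.sum_univ_three] at this
      exact this
    · intro z
      rw [Fin.sum_univ_three]
      have := congrArg (Polynomial.eval z) hU
      rw [Polynomial.eval_add, Polynomial.eval_add, eval_P1, eval_act_P1, eval_act_P1,
        Polynomial.eval_zero] at this
      exact this
  · apply Polynomial.funext
    intro z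
    rw [eval_diag, eval_Q2, eval_P1, pow_add]

theorem exists_a (w : ℕ) (P : Polynomial ℚ) (h : P.natDegree ≤ w) : ∃ a, P1 w a = P := by
  refine ⟨fun m => (-1) ^ (w - m) * P.coeff (w - m) / (w.choose m : ℚ), ?_⟩
  conv_rhs => rw [P.as_sum_range' (w + 1) (by omega), ← Finset.sum_range_reflect]
  unfold P1
  refine Finset.sum_congr rfl fun m hm => ?_
  have hm := Finset.mem_range.1 hm
  have hk' : (w.choose m : ℚ) ≠ 0 := by exact_mod_cast (Nat.choose_pos (by omega)).ne'
  rw [show w + 1 - 1 - m = w - m by omega, ← Polynomial.C_mul_X_pow_eq_monomial,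
    neg_pow (Polynomial.X : Polynomial ℚ), mul_div_cancel₀ _ hk', ← mul_assoc]
  congr 1
  rw [map_mul, map_pow, map_neg, map_one, mul_right_comm, ← mul_pow]
  simp

/-- The diagonal evaluation `ψ : V_{w1,w2}^ℚ[I_D] → W_{w1+w2}^ℚ`, `P(X1,X2) ↦ P(Z,Z)`, is well
defined and surjective, with the explicit rational section
`Σ_m C(w1+w2,m) a_m (-Z)^{w1+w2-m} ↦ Σ_{m1,m2} C(w1,m1) C(w2,m2) a_{m1+m2} (-X1)^{w1-m1} (-X2)^{w2-m2}`. -/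
theorem diag_eval_surjective_with_section (w1 w2 : ℕ) (hw1 : Even w1) (hw2 : Even w2)
    (hw1' : 2 ≤ w1) (hw2' : 2 ≤ w2) :
    (∀ P : MvPolynomial (Fin 2) ℚ, MemVID w1 w2 P → MemW1 (w1 + w2) (diagEval P)) ∧
    (∀ P' : Polynomial ℚ, MemW1 (w1 + w2) P' →
      ∃ P : MvPolynomial (Fin 2) ℚ, MemVID w1 w2 P ∧ diagEval P = P') ∧
    (∀ a : ℕ → ℚ,
      MemW1 (w1 + w2)
        (∑ m ∈ Finset.range (w1 + w2 + 1),
          Polynomial.C ((Nat.choose (w1 + w2) m : ℚ) * a m) * (-Polynomial.X) ^ (w1 + w2 - m)) →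
      MemVID w1 w2
        (∑ m1 ∈ Finset.range (w1 + 1), ∑ m2 ∈ Finset.range (w2 + 1),
          MvPolynomial.C ((Nat.choose w1 m1 : ℚ) * (Nat.choose w2 m2 : ℚ) * a (m1 + m2)) *
            (-MvPolynomial.X 0) ^ (w1 - m1) * (-MvPolynomial.X 1) ^ (w2 - m2)) ∧
      diagEval
        (∑ m1 ∈ Finset.range (w1 + 1), ∑ m2 ∈ Finset.range (w2 + 1),
          MvPolynomial.C ((Nat.choose w1 m1 : ℚ) * (Nat.choose w2 m2 : ℚ) * a (m1 + m2)) *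
            (-MvPolynomial.X 0) ^ (w1 - m1) * (-MvPolynomial.X 1) ^ (w2 - m2)) =
        ∑ m ∈ Finset.range (w1 + w2 + 1),
          Polynomial.C ((Nat.choose (w1 + w2) m : ℚ) * a m) * (-Polynomial.X) ^ (w1 + w2 - m)) := by
  refine ⟨fun P hP => part1 w1 w2 P hP, fun P' hP' => ?_, fun a ha => part3 w1 w2 a ha⟩
  obtain ⟨a, rfl⟩ := exists_a (w1 + w2) P' hP'.1
  exact ⟨_, part3 w1 w2 a hP'⟩
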